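/- Let α,β,δ,N be real with α+β>−1, let ρ be a nonzero real and σ a real number, and define p_n(x) = ρ^n·r_n(ρ^{−1}x−σ; α,β,N,δ). Then for every integer n≥1 and all real x, x·p_n(x) = p_{n+1}(x) + B_n·p_n(x) + C_n·p_{n−1}(x), and x·p_0(x) = p_1(x) + B_0·p_0(x), where C_n = ρ²·n(n+α)(n+β)(n+α+β)(n+β+δ)(δ−α−n)(n+N+α+β+1)(N+1−n)/((2n+α+β−1)(2n+α+β)²(2n+α+β+1)) and B_n = ρ·( (n+α+β+1)(n+α+1)(n+β+δ+1)(N−n)/((2n+α+β+1)(2n+α+β+2)) + n(n+β)(δ−α−n)(n+N+α+β+1)/((2n+α+β)(2n+α+β+1)) + σ ). -/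

import Mathlib

open Filter Real

/-- Pochhammer symbol `(a)_m = a (a+1) ⋯ (a+m-1)`. -/
noncomputable def poch (a : ℝ) (m : ℕ) : ℝ := ∏ j ∈ Finset.range m, (a + j)

/-- Monic Hermite polynomial of degree `n`. -/
noncomputable def monicHermite (n : ℕ) (x : ℝ) : ℝ :=
  (n.factorial : ℝ) * ∑ m ∈ Finset.range (n / 2 + 1),
    (-1 : ℝ) ^ m * x ^ (n - 2 * m) / (4 ^ m * m.factorial * (n - 2 * m).factorial)

/-- Monic Laguerre polynomial of degree `n` with parameter `α`. -/
noncomputable def monicLaguerre (α : ℝ) (n : ℕ) (x : ℝ) : ℝ :=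
  (-1 : ℝ) ^ n * n.factorial * ∑ k ∈ Finset.range (n + 1),
    (-1 : ℝ) ^ k * (poch (α + k + 1) (n - k) / ((n - k).factorial * k.factorial)) * x ^ k

/-- Monic Jacobi polynomial of degree `n` with parameters `α, β`. -/
noncomputable def monicJacobi (α β : ℝ) (n : ℕ) (x : ℝ) : ℝ :=
  ((n.factorial : ℝ) / poch (n + α + β + 1) n) *
    ∑ k ∈ Finset.range (n + 1),
      (poch (n + α - k + 1) k / k.factorial) *
      (poch (β + k + 1) (n - k) / (n - k).factorial) *
      (x - 1) ^ (n - k) * (x + 1) ^ k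

/-- Monic Racah polynomial of degree `n` in the variable `y`. -/
noncomputable def monicRacah (α β N δ : ℝ) (n : ℕ) (y : ℝ) : ℝ :=
  (1 / poch (n + α + β + 1) n) *
    ∑ k ∈ Finset.range (n + 1),
      (poch (-(n : ℝ)) k * poch (n + α + β + 1) k / k.factorial) *
      poch (α + k + 1) (n - k) * poch (β + δ + k + 1) (n - k) * poch (k - N) (n - k) *
      ∏ j ∈ Finset.range k, ((j : ℝ) * (j + δ - N) - y)

/-- Monic Hahn polynomial of degree `n`. -/
noncomputable def monicHahn (α β N : ℝ) (n : ℕ) (x : ℝ) : ℝ :=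
  (1 / poch (n + α + β + 1) n) *
    ∑ k ∈ Finset.range (n + 1),
      (poch (-(n : ℝ)) k * poch (n + α + β + 1) k * poch (-x) k / k.factorial) *
      poch (α + k + 1) (n - k) * poch (k - N) (n - k)

/-- Monic Meixner polynomial of degree `n`. -/
noncomputable def monicMeixner (b c : ℝ) (n : ℕ) (x : ℝ) : ℝ :=
  (c / (c - 1)) ^ n * ∑ k ∈ Finset.range (n + 1),
    (poch (-(n : ℝ)) k * poch (-x) k / k.factorial) * poch (b + k) (n - k) * (1 - 1 / c) ^ k

/-- Monic Krawtchouk polynomial of degree `n`. -/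
noncomputable def monicKrawtchouk (p N : ℝ) (n : ℕ) (x : ℝ) : ℝ :=
  p ^ n * ∑ k ∈ Finset.range (n + 1),
    (poch (-(n : ℝ)) k * poch (-x) k / k.factorial) * poch (k - N) (n - k) * (1 / p) ^ k

/-- `ρ = (α+β)^{3/2} / (αβ)^{1/2}`. -/
noncomputable def jacobiRho (α β : ℝ) : ℝ := (α + β) ^ ((3 : ℝ) / 2) / Real.sqrt (α * β)

/-- `σ = (α-β)/(α+β)`. -/
noncomputable def jacobiSigma (α β : ℝ) : ℝ := (α - β) / (α + β)

/-- Uniformly rescaled monic Jacobi polynomial `p_n(x; α, β) = ρ^n p_n^{(α,β)}(ρ⁻¹x - σ)`. -/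
noncomputable def rescaledJacobi (α β : ℝ) (n : ℕ) (x : ℝ) : ℝ :=
  jacobiRho α β ^ n * monicJacobi α β n (x / jacobiRho α β - jacobiSigma α β)

/-- `ρ = ((α+β)³/(αβ(β+δ)(N+α+β)(δ-α)N))^{1/2}` with `β = bα`, `δ = (bdν+1)α`, `N = bν`. -/
noncomputable def racahRho (α b d ν : ℝ) : ℝ :=
  Real.sqrt ((α + b * α) ^ 3 /
    (α * (b * α) * (b * α + (b * d * ν + 1) * α) * (b * ν + α + b * α) *
      ((b * d * ν + 1) * α - α) * (b * ν)))

/-- `σ = -N(α+1)(β+δ+1)/(α+β+2)` with `β = bα`, `δ = (bdν+1)α`, `N = bν`. -/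
noncomputable def racahSigma (α b d ν : ℝ) : ℝ :=
  -((b * ν) * (α + 1) * (b * α + (b * d * ν + 1) * α + 1)) / (α + b * α + 2)

/-- Rescaled monic Racah polynomial `p_n(x; α, b, d, ν) = ρ^n r_n(ρ⁻¹x - σ; α, bα, bν, (bdν+1)α)`. -/
noncomputable def rescaledRacah (α b d ν : ℝ) (n : ℕ) (x : ℝ) : ℝ :=
  racahRho α b d ν ^ n *
    monicRacah α (b * α) (b * ν) ((b * d * ν + 1) * α) n
      (x / racahRho α b d ν - racahSigma α b d ν)
/-- Rescaled monic Racah polynomials `p_n(x) = ρ^n r_n(ρ⁻¹x - σ; α, β, N, δ)`. -/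
noncomputable def rescaledRacahGen (α β N δ ρ σ : ℝ) (n : ℕ) (x : ℝ) : ℝ :=
  ρ ^ n * monicRacah α β N δ n (x / ρ - σ)

theorem poch_zero (a : ℝ) : poch a 0 = 1 := by simp [poch]

theorem poch_succ (a : ℝ) (m : ℕ) : poch a (m + 1) = poch a m * (a + m) := by
  simp [poch, Finset.prod_range_succ]

theorem poch_succ_left (a : ℝ) (m : ℕ) : poch a (m + 1) = a * poch (a + 1) m := by
  rw [poch, poch, Finset.prod_range_succ', mul_comm]
  push_cast
  congr 1
  · ring
  · exact Finset.prod_congr rfl fun j _ => by ring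

theorem mul_poch_add_one (a : ℝ) (m : ℕ) : a * poch (a + 1) m = poch a m * (a + m) := by
  rw [← poch_succ_left, poch_succ]

theorem poch_pos {a : ℝ} (ha : 0 < a) (m : ℕ) : 0 < poch a m :=
  Finset.prod_pos fun j _ => by positivity

theorem poch_neg_natCast_eq_zero {n k : ℕ} (h : n < k) : poch (-(n : ℝ)) k = 0 :=
  Finset.prod_eq_zero (Finset.mem_range.2 h) (by simp)

theorem poch_neg_natCast_self (n : ℕ) : poch (-(n : ℝ)) n = (-1) ^ n * n.factorial := by
  induction n with
  | zero => simp [poch]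
  | succ n ih =>
    rw [poch_succ_left, show -((n + 1 : ℕ) : ℝ) + 1 = -(n : ℝ) by push_cast; ring, ih,
      Nat.factorial_succ]
    push_cast
    ring

/-- Coefficient of `∏_{j<k} (j (j + δ - N) - y)` in the monic Racah polynomial of degree `n`. -/
noncomputable def racahCoeff (α β N δ : ℝ) (n k : ℕ) : ℝ :=
  (1 / poch (n + α + β + 1) n) *
    ((poch (-(n : ℝ)) k * poch (n + α + β + 1) k / k.factorial) *
      poch (α + k + 1) (n - k) * poch (β + δ + k + 1) (n - k) * poch (k - N) (n - k))

theorem racahCoeff_eq_zero (α β N δ : ℝ) {n k : ℕ} (h : n < k) :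
    racahCoeff α β N δ n k = 0 := by
  simp [racahCoeff, poch_neg_natCast_eq_zero h]

theorem racahCoeff_self {α β : ℝ} (N δ : ℝ) (hαβ : -1 < α + β) (n : ℕ) :
    racahCoeff α β N δ n n = (-1) ^ n := by
  have hn : (0 : ℝ) ≤ n := n.cast_nonneg
  have h := (poch_pos (show 0 < n + α + β + 1 by linarith) n).ne'
  have hf : (n.factorial : ℝ) ≠ 0 := by positivity
  simp only [racahCoeff, Nat.sub_self, poch_zero, poch_neg_natCast_self]
  field_simp

theorem monicRacah_eq_sum (α β N δ y : ℝ) {n M : ℕ} (h : n < M) :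
    monicRacah α β N δ n y = ∑ k ∈ Finset.range M,
      racahCoeff α β N δ n k * ∏ j ∈ Finset.range k, ((j : ℝ) * (j + δ - N) - y) := by
  rw [monicRacah, Finset.mul_sum]
  refine Eq.trans (Finset.sum_congr rfl fun k _ => ?_)
    (Finset.sum_subset (Finset.range_subset_range.2 (Nat.succ_le_of_lt h)) fun k _ hk => ?_)
  · rw [racahCoeff]
    ring
  · rw [racahCoeff_eq_zero, zero_mul]
    rw [Finset.mem_range] at hk
    omega

theorem racahCoeff_succ_degree {α β : ℝ} (N δ : ℝ) (hαβ : -1 < α + β) {n k : ℕ}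
    (hk : k ≤ n + 1) :
    racahCoeff α β N δ (n + 1) k *
        ((n + 1 - k) * (2 * n + α + β + 1) * (2 * n + α + β + 2)) =
      racahCoeff α β N δ n k *
        ((n + 1) * (n + α + β + 1 + k) * (α + n + 1) * (β + δ + n + 1) * (n - N)) := by
  rcases hk.eq_or_lt with rfl | hk
  · rw [racahCoeff_eq_zero α β N δ (Nat.lt_succ_self n)]
    push_cast
    ring
  have hk : k ≤ n := Nat.lt_succ_iff.1 hk
  obtain ⟨d, rfl⟩ := Nat.exists_eq_add_of_le hk
  simp only [racahCoeff, show k + d + 1 - k = d + 1 by omega, show k + d - k = d by omega,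
    poch_succ _ d]
  have hn : (0 : ℝ) ≤ (k + d : ℕ) := Nat.cast_nonneg _
  set n := k + d with hnd
  have hd : (d : ℝ) = n - k := by rw [hnd]; push_cast; ring
  have hs : 0 < (n : ℝ) + α + β + 1 := by linarith
  have h1 := mul_poch_add_one (-((n : ℝ) + 1)) k
  have h2 := mul_poch_add_one ((n : ℝ) + α + β + 1) k
  have h3 : ((n : ℝ) + α + β + 1) * poch ((n : ℝ) + α + β + 1 + 1) (n + 1) =
      poch ((n : ℝ) + α + β + 1) n * (2 * n + α + β + 1) * (2 * n + α + β + 2) := by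
    rw [mul_poch_add_one, poch_succ]
    push_cast
    ring
  rw [show -((n : ℝ) + 1) + 1 = -(n : ℝ) by ring] at h1
  push_cast
  rw [show (n : ℝ) + 1 + α + β + 1 = n + α + β + 1 + 1 by ring, hd]
  have hP := poch_pos hs n
  have hQ := poch_pos (show 0 < (n : ℝ) + α + β + 1 + 1 by linarith) (n + 1)
  have hf : (k.factorial : ℝ) ≠ 0 := by positivity
  generalize poch ((n : ℝ) + α + β + 1 + 1) (n + 1) = Q at *
  generalize poch ((n : ℝ) + α + β + 1) n = P at *
  generalize poch ((n : ℝ) + α + β + 1 + 1) k = q at *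
  generalize poch ((n : ℝ) + α + β + 1) k = p at *
  generalize poch (-((n : ℝ) + 1)) k = u at *
  generalize poch (-(n : ℝ)) k = v at *
  have hu : u * ((n : ℝ) + 1 - k) = (n + 1) * v := by linear_combination h1
  have hq : q * P * ((2 * n + α + β + 1) * (2 * n + α + β + 2)) =
      p * (n + α + β + 1 + k) * Q := by
    refine mul_left_cancel₀ hs.ne' ?_
    linear_combination (P * ((2 * n + α + β + 1) * (2 * n + α + β + 2))) * h2
      - (p * (n + α + β + 1 + k)) * h3
  generalize poch (α + k + 1) d = a
  generalize poch (β + δ + k + 1) d = b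
  generalize poch (k - N) d = c
  field_simp
  have key : u * ((n : ℝ) + 1 - k) * (q * P * ((2 * n + α + β + 1) * (2 * n + α + β + 2))) =
      (n + 1) * v * (p * (n + α + β + 1 + k) * Q) := by rw [hu, hq]
  linear_combination (a * b * c * (α + n + 1) * (β + δ + n + 1) * (n - N)) * key

theorem racahCoeff_succ_index (α β N δ : ℝ) {n k : ℕ} (hk : k < n) :
    racahCoeff α β N δ n (k + 1) *
        ((k + 1) * (α + k + 1) * (β + δ + k + 1) * (k - N)) =
      -(racahCoeff α β N δ n k * ((n - k) * (n + α + β + 1 + k))) := by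
  obtain ⟨d, rfl⟩ := Nat.exists_eq_add_of_lt hk
  simp only [racahCoeff, show k + d + 1 - k = d + 1 by omega,
    show k + d + 1 - (k + 1) = d by omega, poch_succ _ k, poch_succ_left _ d,
    Nat.factorial_succ]
  push_cast
  rw [show α + ((k : ℝ) + 1) + 1 = α + k + 1 + 1 by ring,
    show β + δ + ((k : ℝ) + 1) + 1 = β + δ + k + 1 + 1 by ring,
    show (k : ℝ) + 1 - N = k - N + 1 by ring]
  have hf : (k.factorial : ℝ) ≠ 0 := by positivity
  have hk1 : (k : ℝ) + 1 ≠ 0 := by positivity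
  generalize poch (-((k : ℝ) + d + 1)) k = u
  generalize poch ((k : ℝ) + d + 1 + α + β + 1) k = p
  generalize poch ((k : ℝ) + d + 1 + α + β + 1) (k + d + 1) = P
  generalize poch (α + k + 1 + 1) d = a
  generalize poch (β + δ + k + 1 + 1) d = b
  generalize poch ((k : ℝ) - N + 1) d = c
  field_simp
  ring

theorem racah_rational_identity {n κ α δ N T : ℝ} (h0 : T ≠ 0) (h1 : T + 1 ≠ 0)
    (h2 : T + 2 ≠ 0) (h3 : n + 1 - κ ≠ 0) (h4 : T - n + κ ≠ 0) :
    κ * (κ + δ - N) + κ * (α + κ) * (T - 2 * n - α + δ + κ) * (κ - 1 - N) /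
        ((n + 1 - κ) * (T - n + κ)) =
      (n + 1) * (T - n + 1 + κ) * (α + n + 1) * (T - n - α + δ + 1) * (n - N) /
        ((n + 1 - κ) * (T + 1) * (T + 2))
      + ((T - n + 1) * (n + α + 1) * (T - n - α + δ + 1) * (N - n) / ((T + 1) * (T + 2))
        + n * (T - n - α) * (δ - α - n) * (T - n + N + 1) / (T * (T + 1)))
      - (T - n - α) * (T - n) * (δ - α - n) * (T - n + N + 1) * (n - κ) /
        (T * (T + 1) * (T - n + κ)) := by
  have hfst : (n + 1) * (T - n + 1 + κ) / ((n + 1 - κ) * (T + 2)) - (T - n + 1) / (T + 2) =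
      κ / (n + 1 - κ) := by
    field_simp
    ring
  have hsnd : n / T - (T - n) * (n - κ) / (T * (T - n + κ)) = κ / (T - n + κ) := by
    field_simp
    ring
  have hmain : κ * (κ + δ - N) + κ * (α + κ) * (T - 2 * n - α + δ + κ) * (κ - 1 - N) /
        ((n + 1 - κ) * (T - n + κ)) =
      (α + n + 1) * (T - n - α + δ + 1) * (n - N) / (T + 1) * (κ / (n + 1 - κ))
      + (T - n - α) * (δ - α - n) * (T - n + N + 1) / (T + 1) * (κ / (T - n + κ)) := by
    field_simp
    ring
  rw [hmain, ← hfst, ← hsnd, show n + α + 1 = α + n + 1 by ring, show N - n = -(n - N) by ring]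
  generalize α + n + 1 = a₁
  generalize T - n - α + δ + 1 = a₂
  generalize n - N = a₃
  generalize T - n - α = b₁
  generalize δ - α - n = b₂
  generalize T - n + N + 1 = b₃
  generalize T - n + 1 + κ = c₁
  generalize T - n + κ = c₂
  generalize T - n + 1 = c₃
  generalize T - n = c₄
  generalize n + 1 - κ = c₅
  generalize n - κ = c₆
  generalize T + 1 = T₁
  generalize T + 2 = T₂
  ring

/-- The recurrence for the monic Racah polynomials, on the level of coefficients. -/
theorem racahCoeff_recurrence {α β : ℝ} (N δ : ℝ) (hαβ : -1 < α + β) {n k : ℕ} (hn : 1 ≤ n)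
    (hk : k ≤ n) :
    (k : ℝ) * (k + δ - N) * racahCoeff α β N δ n k
        - (if k = 0 then 0 else racahCoeff α β N δ n (k - 1)) =
      racahCoeff α β N δ (n + 1) k
      + ((n + α + β + 1) * (n + α + 1) * (n + β + δ + 1) * (N - n) /
            ((2 * n + α + β + 1) * (2 * n + α + β + 2))
          + n * (n + β) * (δ - α - n) * (n + N + α + β + 1) /
            ((2 * n + α + β) * (2 * n + α + β + 1))) * racahCoeff α β N δ n k
      + (n * (n + α) * (n + β) * (n + α + β) * (n + β + δ) * (δ - α - n) *
            (n + N + α + β + 1) * (N + 1 - n) /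
          ((2 * n + α + β - 1) * (2 * n + α + β) ^ 2 * (2 * n + α + β + 1)))
          * racahCoeff α β N δ (n - 1) k := by
  obtain ⟨m, rfl⟩ := Nat.exists_eq_add_of_le' hn
  have hup := racahCoeff_succ_degree N δ hαβ (hk.trans (Nat.le_succ _))
  have hdown := racahCoeff_succ_degree N δ hαβ hk
  have hleft : (if k = 0 then 0 else racahCoeff α β N δ (m + 1) (k - 1)) *
      (((m + 1 : ℕ) + 1 - k) * ((m + 1 : ℕ) + α + β + k)) =
      -(racahCoeff α β N δ (m + 1) k * (k * (α + k) * (β + δ + k) * (k - 1 - N))) := by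
    rcases k with _ | j
    · simp
    · have h := racahCoeff_succ_index α β N δ (Nat.lt_of_succ_le hk)
      simp only [Nat.succ_ne_zero, if_false, Nat.add_sub_cancel]
      push_cast at h ⊢
      linear_combination h
  rw [Nat.add_sub_cancel]
  have hkn : (k : ℝ) ≤ m + 1 := by exact_mod_cast hk
  have hk0 : (0 : ℝ) ≤ k := k.cast_nonneg
  have hm0 : (0 : ℝ) ≤ m := m.cast_nonneg
  push_cast at hup hleft ⊢
  generalize racahCoeff α β N δ (m + 1) k = X at *
  generalize racahCoeff α β N δ (m + 1 + 1) k = U at *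
  generalize racahCoeff α β N δ m k = D at *
  generalize (if k = 0 then 0 else racahCoeff α β N δ (m + 1) (k - 1)) = L at *
  generalize (k : ℝ) = κ at *
  obtain ⟨n, hn⟩ : ∃ n : ℝ, n = (m : ℝ) + 1 := ⟨_, rfl⟩
  have hm : (m : ℝ) = n - 1 := by linarith
  rw [hm] at hup hdown hleft hkn hm0 ⊢
  simp only [sub_add_cancel] at hup hdown hleft hkn ⊢
  have e1 : n + 1 - κ ≠ 0 := by linarith
  have e2 : 2 * n + α + β - 1 ≠ 0 := by linarith
  have e3 : 2 * n + α + β ≠ 0 := by linarith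
  have e4 : 2 * n + α + β + 1 ≠ 0 := by linarith
  have e5 : 2 * n + α + β + 2 ≠ 0 := by linarith
  have e6 : n + α + β + κ ≠ 0 := by linarith
  have hU : U = X * ((n + 1) * (n + α + β + 1 + κ) * (α + n + 1) * (β + δ + n + 1) * (n - N)) /
      ((n + 1 - κ) * (2 * n + α + β + 1) * (2 * n + α + β + 2)) := by
    rw [eq_div_iff (by positivity), hup]
  have hL : L = -(X * (κ * (α + κ) * (β + δ + κ) * (κ - 1 - N))) /
      ((n + 1 - κ) * (n + α + β + κ)) := by
    rw [eq_div_iff (by positivity), hleft]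
  have hD : n * (n + α) * (n + β + δ) * (N + 1 - n) * D =
      -(X * ((n - κ) * (2 * n + α + β - 1) * (2 * n + α + β))) / (n + α + β + κ) := by
    rw [eq_div_iff e6]
    linear_combination hdown
  have hC : n * (n + α) * (n + β) * (n + α + β) * (n + β + δ) * (δ - α - n) *
        (n + N + α + β + 1) * (N + 1 - n) /
        ((2 * n + α + β - 1) * (2 * n + α + β) ^ 2 * (2 * n + α + β + 1)) * D =
      (n + β) * (n + α + β) * (δ - α - n) * (n + N + α + β + 1) /
        ((2 * n + α + β - 1) * (2 * n + α + β) ^ 2 * (2 * n + α + β + 1)) *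
        (-(X * ((n - κ) * (2 * n + α + β - 1) * (2 * n + α + β))) / (n + α + β + κ)) := by
    rw [← hD]
    ring
  have key := racah_rational_identity (α := α) (δ := δ) (N := N) (T := 2 * n + α + β)
    e3 e4 e5 e1 (by convert e6 using 1; ring)
  have hcancel : (n + β) * (n + α + β) * (δ - α - n) * (n + N + α + β + 1) /
        ((2 * n + α + β - 1) * (2 * n + α + β) ^ 2 * (2 * n + α + β + 1)) *
        (-(X * ((n - κ) * (2 * n + α + β - 1) * (2 * n + α + β))) / (n + α + β + κ)) =
      -X * ((n + β) * (n + α + β) * (δ - α - n) * (n + N + α + β + 1) * (n - κ) /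
        ((2 * n + α + β) * (2 * n + α + β + 1) * (n + α + β + κ))) := by
    generalize 2 * n + α + β + 1 = T₁
    generalize 2 * n + α + β - 1 = T₂ at e2 ⊢
    generalize 2 * n + α + β = T at e3 ⊢
    field_simp
  rw [hC, hcancel, hU, hL]
  rw [show 2 * n + α + β - n + κ = n + α + β + κ by ring,
    show 2 * n + α + β - n + 1 + κ = n + α + β + 1 + κ by ring,
    show 2 * n + α + β - 2 * n - α = β by ring,
    show 2 * n + α + β - n - α = n + β by ring,
    show 2 * n + α + β - n = n + α + β by ring] at key
  linear_combination X * key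

/-- Three-term recurrence for the monic Racah polynomials. -/
theorem monicRacah_recurrence {α β : ℝ} (N δ y : ℝ) (hαβ : -1 < α + β) {n : ℕ} (hn : 1 ≤ n) :
    y * monicRacah α β N δ n y =
      monicRacah α β N δ (n + 1) y
      + ((n + α + β + 1) * (n + α + 1) * (n + β + δ + 1) * (N - n) /
            ((2 * n + α + β + 1) * (2 * n + α + β + 2))
          + n * (n + β) * (δ - α - n) * (n + N + α + β + 1) /
            ((2 * n + α + β) * (2 * n + α + β + 1))) * monicRacah α β N δ n y
      + (n * (n + α) * (n + β) * (n + α + β) * (n + β + δ) * (δ - α - n) *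
            (n + N + α + β + 1) * (N + 1 - n) /
          ((2 * n + α + β - 1) * (2 * n + α + β) ^ 2 * (2 * n + α + β + 1)))
          * monicRacah α β N δ (n - 1) y := by
  have hshift : y * monicRacah α β N δ n y = ∑ k ∈ Finset.range (n + 2),
      ((k : ℝ) * (k + δ - N) * racahCoeff α β N δ n k
        - (if k = 0 then 0 else racahCoeff α β N δ n (k - 1))) *
        ∏ j ∈ Finset.range k, ((j : ℝ) * (j + δ - N) - y) := by
    rw [Finset.sum_congr rfl fun k _ => sub_mul _ _ _, Finset.sum_sub_distrib,
      Finset.sum_range_succ, racahCoeff_eq_zero α β N δ (Nat.lt_succ_self n), mul_zero,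
      zero_mul, add_zero, Finset.sum_range_succ' _ (n + 1), if_pos rfl, zero_mul, add_zero,
      ← Finset.sum_sub_distrib, monicRacah_eq_sum α β N δ y (Nat.lt_succ_self n),
      Finset.mul_sum]
    refine Finset.sum_congr rfl fun k _ => ?_
    rw [if_neg (Nat.succ_ne_zero k), Nat.add_sub_cancel, Finset.prod_range_succ]
    ring
  rw [hshift, monicRacah_eq_sum α β N δ y (show n + 1 < n + 2 by omega),
    monicRacah_eq_sum α β N δ y (show n < n + 2 by omega),
    monicRacah_eq_sum α β N δ y (show n - 1 < n + 2 by omega), Finset.mul_sum, Finset.mul_sum,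
    ← Finset.sum_add_distrib, ← Finset.sum_add_distrib]
  refine Finset.sum_congr rfl fun k hk => ?_
  rw [← mul_assoc, ← mul_assoc, ← add_mul, ← add_mul]
  congr 1
  rcases (Nat.lt_succ_iff.1 (Finset.mem_range.1 hk)).eq_or_lt with rfl | hk
  · rw [if_neg (Nat.succ_ne_zero n), Nat.add_sub_cancel, racahCoeff_self N δ hαβ,
      racahCoeff_self N δ hαβ, racahCoeff_eq_zero α β N δ (Nat.lt_succ_self n),
      racahCoeff_eq_zero α β N δ (show n - 1 < n + 1 by omega)]
    ring
  · exact racahCoeff_recurrence N δ hαβ hn (Nat.lt_succ_iff.1 hk)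

/-- three-term recurrence for rescaled monic Racah polynomials. -/
theorem rescaled_racah_recurrence (α β δ N ρ σ : ℝ) (hαβ : -1 < α + β) (hρ : ρ ≠ 0) :
    (∀ n : ℕ, 1 ≤ n → ∀ x : ℝ,
      x * rescaledRacahGen α β N δ ρ σ n x =
        rescaledRacahGen α β N δ ρ σ (n + 1) x
        + (ρ * ((n + α + β + 1) * (n + α + 1) * (n + β + δ + 1) * (N - n) /
              ((2 * n + α + β + 1) * (2 * n + α + β + 2))
            + n * (n + β) * (δ - α - n) * (n + N + α + β + 1) /
              ((2 * n + α + β) * (2 * n + α + β + 1))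
            + σ)) * rescaledRacahGen α β N δ ρ σ n x
        + (ρ ^ 2 * (n * (n + α) * (n + β) * (n + α + β) * (n + β + δ) * (δ - α - n) *
              (n + N + α + β + 1) * (N + 1 - n) /
            ((2 * n + α + β - 1) * (2 * n + α + β) ^ 2 * (2 * n + α + β + 1))))
            * rescaledRacahGen α β N δ ρ σ (n - 1) x) ∧
    (∀ x : ℝ,
      x * rescaledRacahGen α β N δ ρ σ 0 x =
        rescaledRacahGen α β N δ ρ σ 1 x
        + (ρ * ((α + β + 1) * (α + 1) * (β + δ + 1) * N /
              ((α + β + 1) * (α + β + 2))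
            + σ)) * rescaledRacahGen α β N δ ρ σ 0 x) := by
  refine ⟨fun n hn x => ?_, fun x => ?_⟩
  · have h := monicRacah_recurrence N δ (x / ρ - σ) hαβ hn
    obtain ⟨m, rfl⟩ := Nat.exists_eq_add_of_le' hn
    simp only [rescaledRacahGen, Nat.add_sub_cancel] at h ⊢
    have hx : x = ρ * (x / ρ - σ + σ) := by field_simp; ring
    generalize x / ρ - σ = y at *
    rw [hx]
    linear_combination ρ ^ (m + 2) * h
  · have h1 : α + β + 1 ≠ 0 := by linarith
    have h2 : α + β + 2 ≠ 0 := by linarith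
    simp only [rescaledRacahGen, monicRacah, poch, Finset.sum_range_succ, Finset.sum_range_zero,
      Finset.prod_range_succ, Finset.prod_range_zero, Nat.sub_self, Nat.sub_zero, zero_add,
      Nat.factorial, Nat.cast_zero, Nat.cast_one]
    rw [show 1 + α + β + 1 + 0 = α + β + 2 by ring]
    field_simp
    ring
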